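/- arXiv:2402.08525 — 2 statements merged into one kernel-verified Lean document; each statement's English description precedes it below -/
import Mathlib

section
/- The first moment equals u₁ = (Σ_{a∈A} a) / (b² − N) · b/(b − N). -/
open MeasureTheory

def Admissible (b : ℕ) (A : Finset ℕ) (n : ℕ) : Prop :=
  (∀ d ∈ Nat.digits b n, d ∈ A) ∧ (n = 0 → 0 ∈ A)

instance (b : ℕ) (A : Finset ℕ) (n : ℕ) : Decidable (Admissible b A n) := by
  unfold Admissible
  infer_instance

noncomputable def kempnerMeasure (b : ℕ) (A : Finset ℕ) : Measure ℝ :=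
  if 0 ∈ A then
    Measure.sum fun l : ℕ =>
      ((b : ENNReal) ^ l)⁻¹ •
        Measure.sum fun n : {n : ℕ // Admissible b A n} =>
          Measure.dirac (((n : ℕ) : ℝ) / (b : ℝ) ^ l)
  else
    Measure.dirac 0 +
      Measure.sum fun l : ℕ =>
        ((b : ENNReal) ^ l)⁻¹ •
          Measure.sum
            (fun n : {n : ℕ // Admissible b A n ∧ l ≤ (Nat.digits b n).length} =>
              Measure.dirac (((n : ℕ) : ℝ) / (b : ℝ) ^ l))

noncomputable def moment (b : ℕ) (A : Finset ℕ) (m : ℕ) : ℝ :=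
  ∫ x in Set.Ico (0 : ℝ) 1, x ^ m ∂(kempnerMeasure b A)

noncomputable def kempnerSum (b : ℕ) (A : Finset ℕ) : ℝ :=
  ∑' n : {n : ℕ // 0 < n ∧ Admissible b A n}, (1 : ℝ) / ((n : ℕ) : ℝ)

/-- Values of all length-`l` digit strings over `A`. -/
def kT (b : ℕ) (A : Finset ℕ) : ℕ → Finset ℕ
  | 0 => {0}
  | l + 1 => (A ×ˢ kT b A l).image fun p => p.1 + b * p.2

theorem kT_inj (b : ℕ) (A : Finset ℕ) (hA : A ⊆ Finset.range b) (s : Finset ℕ) :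
    Set.InjOn (fun p : ℕ × ℕ => p.1 + b * p.2) (A ×ˢ s : Finset (ℕ × ℕ)) := by
  rintro ⟨a, n⟩ h ⟨a', n'⟩ h' e
  simp only [Finset.coe_product, Set.mem_prod, Finset.mem_coe] at h h' e
  have h1 := Finset.mem_range.1 (hA h.1)
  have h2 := Finset.mem_range.1 (hA h'.1)
  have e1 : a = a' := by
    have := congrArg (· % b) e
    simpa [Nat.add_mul_mod_self_left, Nat.mod_eq_of_lt h1, Nat.mod_eq_of_lt h2] using this
  subst e1
  have : n = n' := Nat.eq_of_mul_eq_mul_left (by omega) (Nat.add_left_cancel e)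
  rw [this]

theorem kT_card (b : ℕ) (A : Finset ℕ) (hA : A ⊆ Finset.range b) (l : ℕ) :
    (kT b A l).card = A.card ^ l := by
  induction l with
  | zero => simp [kT]
  | succ l ih =>
    rw [kT, Finset.card_image_of_injOn (kT_inj b A hA _), Finset.card_product, ih, pow_succ']

theorem kT_sum (b : ℕ) (A : Finset ℕ) (hA : A ⊆ Finset.range b) (l : ℕ) :
    ((b : ℝ) - 1) * A.card * ∑ n ∈ kT b A l, (n : ℝ)
      = (∑ a ∈ A, (a : ℝ)) * (A.card : ℝ) ^ l * ((b : ℝ) ^ l - 1) := by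
  induction l with
  | zero => simp [kT]
  | succ l ih =>
    rw [kT, Finset.sum_image (kT_inj b A hA _), Finset.sum_product]
    have : ∑ x ∈ A, ∑ y ∈ kT b A l, ((x + b * y : ℕ) : ℝ)
        = (∑ a ∈ A, (a : ℝ)) * (A.card : ℝ) ^ l
          + A.card * (b * ∑ n ∈ kT b A l, (n : ℝ)) := by
      push_cast
      simp only [Finset.sum_add_distrib, Finset.sum_const, nsmul_eq_mul, ← Finset.mul_sum,
        kT_card b A hA]
      push_cast
      ring
    simp only [this]
    linear_combination (A.card : ℝ) * b * ih

theorem mem_kT_zero (b : ℕ) (hb : 1 < b) (A : Finset ℕ) (hA : A ⊆ Finset.range b)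
    (h0 : 0 ∈ A) (l n : ℕ) : n ∈ kT b A l ↔ Admissible b A n ∧ n < b ^ l := by
  induction l generalizing n with
  | zero =>
    simp only [kT, Finset.mem_singleton, pow_zero, Nat.lt_one_iff]
    constructor
    · rintro rfl; simp [Admissible, h0]
    · exact fun h => h.2
  | succ l ih =>
    simp only [kT, Finset.mem_image, Finset.mem_product, Prod.exists, ih]
    constructor
    · rintro ⟨a, m, ⟨ha, hm, hl⟩, rfl⟩
      have hab := Finset.mem_range.1 (hA ha)
      refine ⟨⟨?_, fun _ => h0⟩, ?_⟩
      · rcases Nat.eq_zero_or_pos (a + b * m) with hz | hz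
        · rw [hz]; simp
        · rw [Nat.digits_def' hb hz, Nat.add_mul_mod_self_left, Nat.mod_eq_of_lt hab,
            Nat.add_mul_div_left _ _ (by omega), Nat.div_eq_of_lt hab, zero_add]
          intro d hd
          rcases List.mem_cons.1 hd with rfl | hd
          · exact ha
          · exact hm.1 d hd
      · rw [pow_succ']; nlinarith
    · rintro ⟨h, hl⟩
      refine ⟨n % b, n / b, ⟨?_, ⟨?_, fun _ => h0⟩, ?_⟩, Nat.mod_add_div n b⟩
      · rcases Nat.eq_zero_or_pos n with rfl | hz
        · simpa using h0
        · apply h.1; rw [Nat.digits_def' hb hz]; simp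
      · rcases Nat.eq_zero_or_pos n with rfl | hz
        · simp
        · intro d hd
          apply h.1; rw [Nat.digits_def' hb hz]; simp [hd]
      · rw [pow_succ] at hl
        exact Nat.div_lt_of_lt_mul (by rwa [mul_comm] at hl)

theorem mem_kT_nonzero (b : ℕ) (hb : 1 < b) (A : Finset ℕ) (hA : A ⊆ Finset.range b)
    (h0 : 0 ∉ A) (l n : ℕ) : n ∈ kT b A l ↔
      (∀ d ∈ Nat.digits b n, d ∈ A) ∧ (Nat.digits b n).length = l := by
  induction l generalizing n with
  | zero =>
    simp only [kT, Finset.mem_singleton]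
    constructor
    · rintro rfl; simp
    · rintro ⟨-, h⟩
      simpa [Nat.digits_eq_nil_iff_eq_zero] using List.length_eq_zero_iff.1 h
  | succ l ih =>
    simp only [kT, Finset.mem_image, Finset.mem_product, Prod.exists, ih]
    constructor
    · rintro ⟨a, m, ⟨ha, hm, hl⟩, rfl⟩
      have hab := Finset.mem_range.1 (hA ha)
      have hz : 0 < a + b * m := by
        rcases Nat.eq_zero_or_pos a with rfl | h
        · exact absurd ha h0
        · omega
      rw [Nat.digits_def' hb hz, Nat.add_mul_mod_self_left, Nat.mod_eq_of_lt hab,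
            Nat.add_mul_div_left _ _ (by omega), Nat.div_eq_of_lt hab, zero_add]
      refine ⟨?_, by simp [hl]⟩
      intro d hd
      rcases List.mem_cons.1 hd with rfl | hd
      · exact ha
      · exact hm d hd
    · rintro ⟨h, hl⟩
      rcases Nat.eq_zero_or_pos n with rfl | hz
      · simp at hl
      rw [Nat.digits_def' hb hz] at h hl
      refine ⟨n % b, n / b, ⟨?_, ?_, ?_⟩, Nat.mod_add_div n b⟩
      · apply h; simp
      · intro d hd
        apply h; simp [hd]
      · simpa using hl

theorem k_inner (b : ℕ) (hb : 1 < b) (l : ℕ) (P : ℕ → Prop) (T : Finset ℕ)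
    (h : ∀ n, n ≠ 0 → (n ∈ T ↔ P n ∧ n < b ^ l)) :
    ∑' n : {n : ℕ // P n}, (Set.Ico (0 : ℝ) 1).indicator (fun x => ENNReal.ofReal x)
        (((n : ℕ) : ℝ) / (b : ℝ) ^ l)
      = ENNReal.ofReal ((∑ n ∈ T, (n : ℝ)) / (b : ℝ) ^ l) := by
  classical
  have hbl : (0 : ℝ) < (b : ℝ) ^ l := by positivity
  have := tsum_subtype {n : ℕ | P n} (fun n : ℕ =>
    (Set.Ico (0 : ℝ) 1).indicator (fun x => ENNReal.ofReal x) ((n : ℝ) / (b : ℝ) ^ l))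
  refine Eq.trans this ?_
  rw [Finset.sum_div, ENNReal.ofReal_sum_of_nonneg (fun i _ => by positivity),
    tsum_eq_sum (s := T)]
  · refine Finset.sum_congr rfl fun n hn => ?_
    rcases eq_or_ne n 0 with rfl | hz
    · simp [Set.indicator_apply]
    · obtain ⟨h1, h2⟩ := (h n hz).1 hn
      rw [Set.indicator_of_mem (show n ∈ {n | P n} from h1), Set.indicator_of_mem]
      refine ⟨by positivity, ?_⟩
      rw [div_lt_one hbl]
      exact_mod_cast h2
  · intro n hn
    rcases eq_or_ne n 0 with rfl | hz
    · simp [Set.indicator_apply]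
    · by_cases h1 : P n
      · rw [Set.indicator_of_mem (show n ∈ {n | P n} from h1), Set.indicator_of_notMem]
        rintro ⟨-, h3⟩
        rw [div_lt_one hbl] at h3
        exact hn ((h n hz).2 ⟨h1, by exact_mod_cast h3⟩)
      · exact Set.indicator_of_notMem h1 _

theorem k_lintegral (b : ℕ) (hb : 1 < b) (A : Finset ℕ) (hA : A ⊆ Finset.range b) :
    ∫⁻ x in Set.Ico (0 : ℝ) 1, ENNReal.ofReal x ∂(kempnerMeasure b A)
      = ∑' l : ℕ, ENNReal.ofReal ((∑ n ∈ kT b A l, (n : ℝ)) / ((b : ℝ) ^ l * (b : ℝ) ^ l)) := by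
  have key : ∀ (l : ℕ) (P : ℕ → Prop) (h : ∀ n, n ≠ 0 → (n ∈ kT b A l ↔ P n ∧ n < b ^ l)),
      ∫⁻ x, (Set.Ico (0 : ℝ) 1).indicator (fun x => ENNReal.ofReal x) x
        ∂(((b : ENNReal) ^ l)⁻¹ • Measure.sum fun n : {n : ℕ // P n} =>
          Measure.dirac (((n : ℕ) : ℝ) / (b : ℝ) ^ l))
      = ENNReal.ofReal ((∑ n ∈ kT b A l, (n : ℝ)) / ((b : ℝ) ^ l * (b : ℝ) ^ l)) := by
    intro l P h
    rw [lintegral_smul_measure, lintegral_sum_measure]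
    simp only [lintegral_dirac]
    rw [k_inner b hb l P _ h, smul_eq_mul]
    have hbl : (0 : ℝ) < (b : ℝ) ^ l := by positivity
    have : ((b : ENNReal) ^ l)⁻¹ = ENNReal.ofReal (((b : ℝ) ^ l)⁻¹) := by
      rw [ENNReal.ofReal_inv_of_pos hbl, ENNReal.ofReal_pow (by positivity),
        ENNReal.ofReal_natCast]
    rw [this, ← ENNReal.ofReal_mul (by positivity)]
    congr 1
    field_simp
  rw [← lintegral_indicator measurableSet_Ico]
  unfold kempnerMeasure
  split_ifs with h0
  · rw [lintegral_sum_measure]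
    refine tsum_congr fun l => key l _ fun n _ => mem_kT_zero b hb A hA h0 l n
  · rw [lintegral_add_measure, lintegral_sum_measure, lintegral_dirac]
    have hz : (Set.Ico (0 : ℝ) 1).indicator (fun x => ENNReal.ofReal x) 0 = 0 := by
      simp [Set.indicator_apply]
    rw [hz, zero_add]
    refine tsum_congr fun l => key l _ fun n hn => ?_
    rw [mem_kT_nonzero b hb A hA h0, ← Nat.digits_length_le_iff hb]
    simp only [Admissible, hn, false_imp_iff, and_true]
    constructor
    · rintro ⟨h1, h2⟩; exact ⟨⟨h1, h2.ge⟩, h2.le⟩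
    · rintro ⟨⟨h1, h2⟩, h3⟩; exact ⟨h1, le_antisymm h3 h2⟩

theorem k_hasSum (b : ℕ) (hb : 1 < b) (A : Finset ℕ)
    (hA : A ⊂ Finset.range b) (hAne : A.Nonempty) :
    HasSum (fun l : ℕ => (∑ n ∈ kT b A l, (n : ℝ)) / ((b : ℝ) ^ l * (b : ℝ) ^ l))
      ((∑ a ∈ A, (a : ℝ)) / ((b : ℝ) ^ 2 - (A.card : ℝ))
          * ((b : ℝ) / ((b : ℝ) - (A.card : ℝ)))) := by
  have hb1 : (1 : ℝ) < b := by exact_mod_cast hb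
  have hN : (0 : ℝ) < A.card := by exact_mod_cast hAne.card_pos
  have hNb : (A.card : ℝ) < b := by
    have := Finset.card_lt_card hA
    rw [Finset.card_range] at this
    exact_mod_cast this
  have hNb2 : (A.card : ℝ) < (b : ℝ) ^ 2 := by nlinarith
  have g1 := hasSum_geometric_of_lt_one (r := (A.card : ℝ) / b) (by positivity)
    ((div_lt_one (by positivity)).2 hNb)
  have g2 := hasSum_geometric_of_lt_one (r := (A.card : ℝ) / (b : ℝ) ^ 2) (by positivity)
    ((div_lt_one (by positivity)).2 hNb2)
  have g := (g1.sub g2).mul_left ((∑ a ∈ A, (a : ℝ)) / (((b : ℝ) - 1) * A.card))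
  have e1 : (b : ℝ) - 1 ≠ 0 := by linarith
  have e2 : (b : ℝ) - A.card ≠ 0 := by linarith
  have e3 : (b : ℝ) ^ 2 - A.card ≠ 0 := by linarith
  have e4 : (b : ℝ) ≠ 0 := by linarith
  have c1 : (fun l : ℕ => (∑ n ∈ kT b A l, (n : ℝ)) / ((b : ℝ) ^ l * (b : ℝ) ^ l))
      = fun l : ℕ => (∑ a ∈ A, (a : ℝ)) / (((b : ℝ) - 1) * A.card)
        * (((A.card : ℝ) / b) ^ l - ((A.card : ℝ) / (b : ℝ) ^ 2) ^ l) := by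
    funext l
    have := kT_sum b A hA.1 l
    rw [div_pow, div_pow, ← pow_mul, mul_comm 2 l, pow_mul]
    have hbl : (b : ℝ) ^ l ≠ 0 := by positivity
    field_simp
    linear_combination this
  have c2 : (∑ a ∈ A, (a : ℝ)) / ((b : ℝ) ^ 2 - (A.card : ℝ))
          * ((b : ℝ) / ((b : ℝ) - (A.card : ℝ)))
      = (∑ a ∈ A, (a : ℝ)) / (((b : ℝ) - 1) * A.card)
        * ((1 - (A.card : ℝ) / b)⁻¹ - (1 - (A.card : ℝ) / (b : ℝ) ^ 2)⁻¹) := by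
    have f1 : (1 - (A.card : ℝ) / b)⁻¹ = b / (b - A.card) := by
      rw [one_sub_div e4, inv_div]
    have f2 : (1 - (A.card : ℝ) / (b : ℝ) ^ 2)⁻¹ = (b : ℝ) ^ 2 / ((b : ℝ) ^ 2 - A.card) := by
      rw [one_sub_div (pow_ne_zero 2 e4), inv_div]
    rw [f1, f2]
    field_simp
    ring
  rw [c1, c2]
  exact g

theorem kempner_first_moment (b : ℕ) (hb : 1 < b) (A : Finset ℕ)
    (hA : A ⊂ Finset.range b) (hAne : A.Nonempty) (hA0 : A ≠ {0}) :
    moment b A 1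
      = (∑ a ∈ A, (a : ℝ)) / ((b : ℝ) ^ 2 - (A.card : ℝ))
          * ((b : ℝ) / ((b : ℝ) - (A.card : ℝ))) := by
  have hs := k_hasSum b hb A hA hAne
  have hnn : ∀ l : ℕ, 0 ≤ (∑ n ∈ kT b A l, (n : ℝ)) / ((b : ℝ) ^ l * (b : ℝ) ^ l) :=
    fun l => by positivity
  unfold moment
  simp only [pow_one]
  have hae : 0 ≤ᵐ[(kempnerMeasure b A).restrict (Set.Ico (0 : ℝ) 1)] fun x : ℝ => x :=
    (ae_restrict_iff' measurableSet_Ico).2 (Filter.Eventually.of_forall fun x hx => hx.1)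
  rw [integral_eq_lintegral_of_nonneg_ae hae
    measurable_id.aestronglyMeasurable, k_lintegral b hb A hA.1,
    ← ENNReal.ofReal_tsum_of_nonneg hnn hs.summable, hs.tsum_eq,
    ENNReal.toReal_ofReal (hs.nonneg hnn)]
end

section
/- One has λ₁ = 1 and, for every m ≥ 2, the two-sided bound b^{−1} < λ_m < 1. -/
open MeasureTheory

noncomputable def kempnerLambda (b : ℕ) (A : Finset ℕ) (hAne : A.Nonempty) (m : ℕ) : ℝ :=
  (m : ℝ) * (((b : ℝ) - 1) / ((A.max' hAne : ℕ) : ℝ)) ^ (m - 1)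
    * moment b A (m - 1) / moment b A 0


/-- Strings of length `l` over `A`, as integers. -/
def kD (b : ℕ) (A : Finset ℕ) (l : ℕ) : Finset ℕ :=
  (Finset.range (b ^ l)).filter (fun n => ∀ i ∈ Finset.range l, n / b ^ i % b ∈ A)

/-- Level sums. -/
noncomputable def kS (b : ℕ) (A : Finset ℕ) (l m : ℕ) : ℝ :=
  ∑ n ∈ kD b A l, ((n : ℝ) / (b : ℝ) ^ l) ^ m

lemma mem_kD {b : ℕ} {A : Finset ℕ} {l n : ℕ} :
    n ∈ kD b A l ↔ n < b ^ l ∧ ∀ i < l, n / b ^ i % b ∈ A := by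
  simp [kD]

lemma kS_zero (b : ℕ) (A : Finset ℕ) (m : ℕ) : kS b A 0 m = 0 ^ m := by
  have : kD b A 0 = {0} := by
    ext n; simp [mem_kD]
  simp [kS, this]

lemma digits_mem_iff {b : ℕ} (hb : 1 < b) (A : Finset ℕ) (n : ℕ) :
    (∀ d ∈ Nat.digits b n, d ∈ A) ↔ ∀ i < (Nat.digits b n).length, n / b ^ i % b ∈ A := by
  rw [List.forall_mem_iff_getElem]
  refine forall_congr' fun i => forall_congr' fun hi => ?_
  rw [← Nat.getD_digits n i (by omega), List.getD_eq_getElem _ _ hi]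

lemma len_le_iff {b : ℕ} (hb : 1 < b) (n l : ℕ) :
    (Nat.digits b n).length ≤ l ↔ n < b ^ l := by
  exact Nat.digits_length_le_iff hb n

lemma kD_of_mem {b : ℕ} (hb : 1 < b) {A : Finset ℕ} (h0 : 0 ∈ A) (l n : ℕ) :
    (Admissible b A n ∧ n < b ^ l) ↔ n ∈ kD b A l := by
  rw [mem_kD, Admissible, digits_mem_iff hb]
  have hz : ∀ i, (Nat.digits b n).length ≤ i → n / b ^ i % b = 0 := fun i hi => by
    rw [Nat.div_eq_of_lt ((len_le_iff hb n i).1 hi)]; simp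
  constructor
  · rintro ⟨⟨h1, -⟩, h2⟩
    refine ⟨h2, fun i _ => ?_⟩
    by_cases hi : i < (Nat.digits b n).length
    · exact h1 i hi
    · rw [hz i (by omega)]; exact h0
  · rintro ⟨h1, h2⟩
    have := (len_le_iff hb n l).2 h1
    exact ⟨⟨fun i hi => h2 i (by omega), fun _ => h0⟩, h1⟩

lemma kD_of_notMem {b : ℕ} (hb : 1 < b) {A : Finset ℕ} (h0 : 0 ∉ A) (l n : ℕ) :
    ((Admissible b A n ∧ l + 1 ≤ (Nat.digits b n).length) ∧ n < b ^ (l + 1))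
      ↔ n ∈ kD b A (l + 1) := by
  rw [mem_kD, Admissible, digits_mem_iff hb]
  constructor
  · rintro ⟨⟨⟨h1, -⟩, h3⟩, h2⟩
    exact ⟨h2, fun i _ => h1 i (by omega)⟩
  · rintro ⟨h1, h2⟩
    have h4 := (len_le_iff hb n (l + 1)).2 h1
    have h5 : l + 1 ≤ (Nat.digits b n).length := by
      by_contra hc
      have h6 : n < b ^ l := (len_le_iff hb n l).1 (by omega)
      have := h2 l (by omega)
      rw [Nat.div_eq_of_lt h6] at this
      exact h0 (by simpa using this)
    refine ⟨⟨⟨fun i hi => h2 i (by omega), ?_⟩, h5⟩, h1⟩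
    rintro rfl
    simp at h5

lemma kD_succ_sum {b : ℕ} (hb : 1 < b) {A : Finset ℕ} (hA : A ⊆ Finset.range b) (l : ℕ)
    (g : ℕ → ℝ) :
    ∑ n ∈ kD b A (l + 1), g n = ∑ a ∈ A, ∑ n ∈ kD b A l, g (a * b ^ l + n) := by
  rw [← Finset.sum_product']
  have hpos : 0 < b ^ l := by positivity
  symm
  refine Finset.sum_bij' (fun p _ => p.1 * b ^ l + p.2) (fun n _ => (n / b ^ l, n % b ^ l))
    ?_ ?_ ?_ ?_ ?_
  · rintro ⟨a, n⟩ h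
    simp only [Finset.mem_product, mem_kD] at h ⊢
    obtain ⟨ha, hn, hd⟩ := h
    have hab := Finset.mem_range.1 (hA ha)
    constructor
    · rw [pow_succ]; nlinarith
    · intro i hi
      rcases Nat.lt_succ_iff_lt_or_eq.1 hi with h | rfl
      · obtain ⟨k, rfl⟩ := Nat.exists_eq_add_of_lt h
        have e : a * b ^ (i + k + 1) + n = b ^ i * (b * (a * b ^ k)) + n := by ring
        rw [e, Nat.mul_add_div (by positivity), Nat.mul_add_mod]
        exact hd i h
      · rw [mul_comm, Nat.mul_add_div hpos, Nat.div_eq_of_lt hn, add_zero, Nat.mod_eq_of_lt hab]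
        exact ha
  · intro n h
    simp only [Finset.mem_product, mem_kD] at h ⊢
    obtain ⟨hn, hd⟩ := h
    refine ⟨?_, Nat.mod_lt _ hpos, fun i hi => ?_⟩
    · have := hd l (by omega)
      rwa [Nat.mod_eq_of_lt] at this
      rw [Nat.div_lt_iff_lt_mul hpos]; rw [pow_succ] at hn; linarith
    · have := hd i (by omega)
      obtain ⟨k, rfl⟩ := Nat.exists_eq_add_of_lt hi
      have e := Nat.div_add_mod n (b ^ (i + k + 1))
      rw [← e] at this
      have e2 : b ^ (i + k + 1) * (n / b ^ (i + k + 1)) = b ^ i * (b * (b ^ k * (n / b ^ (i + k + 1)))) := by ring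
      rw [e2, Nat.mul_add_div (by positivity), Nat.mul_add_mod] at this
      exact this
  · rintro ⟨a, n⟩ h
    simp only [Finset.mem_product, mem_kD] at h ⊢
    obtain ⟨ha, hn, hd⟩ := h
    rw [mul_comm, Nat.mul_add_div hpos, Nat.div_eq_of_lt hn, Nat.mul_add_mod, Nat.mod_eq_of_lt hn]
    rfl
  · intro n _
    simp only
    rw [mul_comm]; exact Nat.div_add_mod _ _
  · intro p _; rfl

lemma kS_succ {b : ℕ} (hb : 1 < b) {A : Finset ℕ} (hA : A ⊆ Finset.range b) (l m : ℕ) :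
    kS b A (l + 1) m = ((b : ℝ) ^ m)⁻¹ * ∑ a ∈ A, ∑ j ∈ Finset.range (m + 1),
      (a : ℝ) ^ (m - j) * (m.choose j) * kS b A l j := by
  have hb0 : (b : ℝ) ≠ 0 := by positivity
  rw [kS, kD_succ_sum hb hA, Finset.mul_sum]
  refine Finset.sum_congr rfl fun a _ => ?_
  simp only [kS, Finset.mul_sum]
  rw [Finset.sum_comm]
  refine Finset.sum_congr rfl fun n _ => ?_
  have : ((a * b ^ l + n : ℕ) : ℝ) / (b : ℝ) ^ (l + 1) = ((n : ℝ) / (b : ℝ) ^ l + a) / b := by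
    push_cast; field_simp; ring
  rw [this, div_pow, add_pow, div_eq_inv_mul, Finset.mul_sum]
  refine Finset.sum_congr rfl fun j _ => ?_
  ring

lemma kS_nonneg (b : ℕ) (A : Finset ℕ) (l m : ℕ) : 0 ≤ kS b A l m :=
  Finset.sum_nonneg fun n _ => by positivity

lemma kS_card {b : ℕ} (hb : 1 < b) {A : Finset ℕ} (hA : A ⊆ Finset.range b) (l : ℕ) :
    kS b A l 0 = (A.card : ℝ) ^ l := by
  induction l with
  | zero => simp [kS_zero]
  | succ l ih => rw [kS_succ hb hA]; simp [ih, pow_succ, mul_comm]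

lemma kS_le {b : ℕ} (hb : 1 < b) {A : Finset ℕ} (hA : A ⊆ Finset.range b) (l m : ℕ) :
    kS b A l m ≤ (A.card : ℝ) ^ l := by
  rw [← kS_card hb hA, kS, kS]
  refine Finset.sum_le_sum fun n hn => ?_
  rw [pow_zero]
  refine pow_le_one₀ (by positivity) ?_
  rw [div_le_one (by positivity)]
  exact_mod_cast (mem_kD.1 hn).1.le

lemma card_lt {b : ℕ} {A : Finset ℕ} (hA : A ⊂ Finset.range b) : A.card < b := by
  simpa using Finset.card_lt_card hA

lemma kS_summable {b : ℕ} (hb : 1 < b) {A : Finset ℕ} (hA : A ⊂ Finset.range b) (m : ℕ) :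
    Summable fun l => ((b : ℝ) ^ l)⁻¹ * kS b A l m := by
  have h1 : ((A.card : ℝ) / b) < 1 := by
    rw [div_lt_one (by positivity)]; exact_mod_cast card_lt hA
  refine Summable.of_nonneg_of_le (fun l => mul_nonneg (by positivity) (kS_nonneg ..)) (fun l => ?_)
    (summable_geometric_of_lt_one (by positivity) h1)
  rw [div_pow, div_eq_inv_mul]
  exact mul_le_mul_of_nonneg_left (kS_le hb hA.1 l m) (by positivity)

noncomputable def kU (b : ℕ) (A : Finset ℕ) (m : ℕ) : ℝ := ∑' l, ((b : ℝ) ^ l)⁻¹ * kS b A l m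

lemma kU_nonneg (b : ℕ) (A : Finset ℕ) (m : ℕ) : 0 ≤ kU b A m :=
  tsum_nonneg fun l => mul_nonneg (by positivity) (kS_nonneg ..)

lemma kU_rec {b : ℕ} (hb : 1 < b) {A : Finset ℕ} (hA : A ⊂ Finset.range b) (m : ℕ) :
    kU b A m = 0 ^ m + ((b : ℝ) ^ (m + 1))⁻¹ * ∑ a ∈ A, ∑ j ∈ Finset.range (m + 1),
      (a : ℝ) ^ (m - j) * (m.choose j) * kU b A j := by
  have hb0 : (b : ℝ) ≠ 0 := by positivity
  rw [kU, (kS_summable hb hA m).tsum_eq_zero_add, kS_zero]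
  congr 1
  · simp
  have key : HasSum (fun l => ((b : ℝ) ^ (m + 1))⁻¹ * ∑ a ∈ A, ∑ j ∈ Finset.range (m + 1),
      (a : ℝ) ^ (m - j) * (m.choose j) * (((b : ℝ) ^ l)⁻¹ * kS b A l j))
      (((b : ℝ) ^ (m + 1))⁻¹ * ∑ a ∈ A, ∑ j ∈ Finset.range (m + 1),
      (a : ℝ) ^ (m - j) * (m.choose j) * kU b A j) := by
    refine HasSum.mul_left _ (hasSum_sum fun a _ => hasSum_sum fun j _ => HasSum.mul_left _ ?_)
    exact (kS_summable hb hA j).hasSum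
  rw [← key.tsum_eq]
  refine tsum_congr fun l => ?_
  rw [kS_succ hb hA.1]
  simp only [Finset.mul_sum]
  refine Finset.sum_congr rfl fun a _ => Finset.sum_congr rfl fun j _ => ?_
  rw [pow_succ, pow_succ]; field_simp

lemma kU_eq {b : ℕ} (hb : 1 < b) {A : Finset ℕ} (hA : A ⊂ Finset.range b) (m : ℕ) :
    moment b A m = kU b A m := by
  have hbpos : (0 : ℝ) < b := by positivity
  have hbi : ∀ l : ℕ, ((b : ENNReal) ^ l)⁻¹ = ENNReal.ofReal (((b : ℝ) ^ l)⁻¹) := fun l => by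
    rw [ENNReal.ofReal_inv_of_pos (by positivity), ENNReal.ofReal_pow (by positivity),
      ENNReal.ofReal_natCast]
  set g : ℝ → ENNReal := (Set.Ico (0 : ℝ) 1).indicator (fun x => ENNReal.ofReal (x ^ m)) with hg
  have hgm : Measurable g := by
    refine Measurable.indicator ?_ measurableSet_Ico
    fun_prop
  have inner : ∀ (l : ℕ) (Q : ℕ → Prop), (∀ n, (Q n ∧ n < b ^ l) ↔ n ∈ kD b A l) →
      ∑' n : {n : ℕ // Q n}, g (((n : ℕ) : ℝ) / (b : ℝ) ^ l) = ENNReal.ofReal (kS b A l m) := by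
    intro l Q hQ
    have e := tsum_subtype {n : ℕ | Q n} (fun n : ℕ => g ((n : ℝ) / (b : ℝ) ^ l))
    refine (e.trans ?_)
    rw [tsum_eq_sum (s := kD b A l), kS, ENNReal.ofReal_sum_of_nonneg (fun n _ => by positivity)]
    · refine Finset.sum_congr rfl fun n hn => ?_
      obtain ⟨h1, h2⟩ := (hQ n).2 hn
      rw [Set.indicator_of_mem (by exact h1), hg, Set.indicator_of_mem]
      refine ⟨by positivity, ?_⟩
      rw [div_lt_one (by positivity)]
      exact_mod_cast h2
    · intro n hn
      by_cases h1 : Q n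
      · rw [Set.indicator_of_mem (by exact h1), hg, Set.indicator_of_notMem]
        rintro ⟨-, h3⟩
        rw [div_lt_one (by positivity)] at h3
        exact hn ((hQ n).1 ⟨h1, by exact_mod_cast h3⟩)
      · exact Set.indicator_of_notMem (by exact h1) _
  have tot : ∑' l, ENNReal.ofReal (((b : ℝ) ^ l)⁻¹) * ENNReal.ofReal (kS b A l m)
      = ENNReal.ofReal (kU b A m) := by
    rw [kU, ENNReal.ofReal_tsum_of_nonneg (fun l => mul_nonneg (by positivity) (kS_nonneg ..))
      (kS_summable hb hA m)]
    refine tsum_congr fun l => ?_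
    rw [ENNReal.ofReal_mul (by positivity)]
  have lint : ∫⁻ x, g x ∂(kempnerMeasure b A) = ENNReal.ofReal (kU b A m) := by
    rw [← tot, kempnerMeasure]
    split_ifs with h0
    · rw [lintegral_sum_measure]
      refine tsum_congr fun l => ?_
      rw [lintegral_smul_measure, lintegral_sum_measure, smul_eq_mul, hbi]
      simp only [lintegral_dirac' _ hgm]
      rw [inner l _ (kD_of_mem hb h0 l)]
    · rw [lintegral_add_measure, lintegral_sum_measure, lintegral_dirac' _ hgm,
        tsum_eq_zero_add' ENNReal.summable,
        tsum_eq_zero_add' (f := fun l => ENNReal.ofReal (((b : ℝ) ^ l)⁻¹)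
          * ENNReal.ofReal (kS b A l m)) ENNReal.summable]
      simp only [lintegral_smul_measure, lintegral_sum_measure, smul_eq_mul, hbi,
        lintegral_dirac' _ hgm]
      rw [← add_assoc]
      congr 1
      · have : ∑' n : {n : ℕ // Admissible b A n ∧ 0 ≤ (Nat.digits b n).length},
            g (((n : ℕ) : ℝ) / (b : ℝ) ^ 0) = 0 := by
          rw [ENNReal.tsum_eq_zero]
          rintro ⟨n, h1, -⟩
          rw [hg, Set.indicator_of_notMem]
          rintro ⟨-, h3⟩
          have : n < 1 := by
            simp only [pow_zero, div_one] at h3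
            exact_mod_cast h3
          exact h0 (h1.2 (by omega))
        rw [this, kS_zero]
        simp [hg]
      · refine tsum_congr fun l => ?_
        rw [inner (l + 1) _ (kD_of_notMem hb h0 l)]
  rw [moment, integral_eq_lintegral_of_nonneg_ae]
  · rw [← lintegral_indicator measurableSet_Ico]
    rw [show (∫⁻ x, (Set.Ico (0 : ℝ) 1).indicator (fun x => ENNReal.ofReal (x ^ m)) x
      ∂(kempnerMeasure b A)) = _ from lint, ENNReal.toReal_ofReal (kU_nonneg ..)]
  · refine (ae_restrict_iff' measurableSet_Ico).2 (Filter.Eventually.of_forall fun x hx => ?_)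
    exact pow_nonneg hx.1 m
  · exact (by fun_prop : Measurable fun x : ℝ => x ^ m).aestronglyMeasurable

lemma T_eq (k : ℝ) (m : ℕ) :
    ∑ j ∈ Finset.range (m + 1), k ^ (m - j) * (m.choose j) * (1 / ((j : ℝ) + 1))
      = ((k + 1) ^ (m + 1) - k ^ (m + 1)) / ((m : ℝ) + 1) := by
  have h := add_pow (1 : ℝ) k (m + 1)
  rw [Finset.sum_range_succ'] at h
  rw [add_comm k 1, h]
  simp only [one_pow, one_mul, Nat.choose_zero_right, Nat.cast_one, mul_one, Nat.sub_zero,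
    add_sub_cancel_right, Nat.add_sub_add_right, pow_zero]
  rw [Finset.sum_div]
  refine Finset.sum_congr rfl fun j _ => ?_
  have h2 : ((m : ℝ) + 1) * (m.choose j) = ((m + 1).choose (j + 1)) * ((j : ℝ) + 1) := by
    exact_mod_cast Nat.add_one_mul_choose_eq m j
  field_simp
  linear_combination k ^ (m - j) * h2

lemma upper_aux {b : ℕ} (hb : 1 < b) {A : Finset ℕ} (hcard : A.card < b) {f : ℕ}
    (hf0 : 0 < f) (hfb : f < b) (hf : ∀ a ∈ A, a ≤ f) (e : ℕ → ℝ) (he0 : e 0 = 1)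
    (hpos : ∀ j, 0 ≤ e j)
    (hrec : ∀ m, 1 ≤ m → (b : ℝ) ^ (m + 1) * e m = ∑ a ∈ A, ∑ j ∈ Finset.range (m + 1),
      (((b : ℝ) - 1) / f * a) ^ (m - j) * (m.choose j) * e j) (m : ℕ) (hm : 1 ≤ m) :
    e m < 1 / ((m : ℝ) + 1) := by
  induction m using Nat.strong_induction_on with
  | _ m ih =>
  have hle : ∀ j < m, e j ≤ 1 / ((j : ℝ) + 1) := by
    intro j hj
    rcases Nat.eq_zero_or_pos j with rfl | h
    · simp [he0]
    · exact (ih j hj h).le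
  have hb1 : (1 : ℝ) < b := by exact_mod_cast hb
  have hfb' : (f : ℝ) + 1 ≤ b := by exact_mod_cast hfb
  have hf0' : (0 : ℝ) < f := by exact_mod_cast hf0
  have step1 : ∀ a ∈ A, ∑ j ∈ Finset.range (m + 1),
      (((b : ℝ) - 1) / f * a) ^ (m - j) * (m.choose j) * e j ≤
      ((((a + (b - 1 - f) : ℕ) : ℝ) + 1) ^ (m + 1) - ((a + (b - 1 - f) : ℕ) : ℝ) ^ (m + 1))
        / ((m : ℝ) + 1) + (e m - 1 / ((m : ℝ) + 1)) := by
    intro a ha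
    have haf : (a : ℝ) ≤ f := by exact_mod_cast hf a ha
    have hk : ((b : ℝ) - 1) / f * a ≤ ((a + (b - 1 - f) : ℕ) : ℝ) := by
      rw [Nat.cast_add, Nat.cast_sub (by omega), Nat.cast_sub (by omega), div_mul_eq_mul_div,
        div_le_iff₀ hf0']
      push_cast
      nlinarith
    have hk0 : 0 ≤ ((b : ℝ) - 1) / f * a :=
      mul_nonneg (div_nonneg (by linarith) hf0'.le) (by positivity)
    rw [← T_eq, Finset.sum_range_succ, Finset.sum_range_succ]
    have : ∑ j ∈ Finset.range m, (((b : ℝ) - 1) / f * a) ^ (m - j) * (m.choose j) * e j ≤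
        ∑ j ∈ Finset.range m, ((a + (b - 1 - f) : ℕ) : ℝ) ^ (m - j) * (m.choose j)
          * (1 / ((j : ℝ) + 1)) := by
      refine Finset.sum_le_sum fun j hj => ?_
      refine mul_le_mul ?_ (hle j (Finset.mem_range.1 hj)) (hpos j) (by positivity)
      exact mul_le_mul_of_nonneg_right (pow_le_pow_left₀ hk0 hk _) (by positivity)
    simp only [Nat.sub_self, pow_zero, Nat.choose_self, Nat.cast_one, one_mul]
    linarith
  have step2 := Finset.sum_le_sum step1
  rw [← hrec m hm, Finset.sum_add_distrib, ← Finset.sum_div, Finset.sum_const, nsmul_eq_mul] at step2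
  have step3 : ∑ a ∈ A, ((((a + (b - 1 - f) : ℕ) : ℝ) + 1) ^ (m + 1)
      - ((a + (b - 1 - f) : ℕ) : ℝ) ^ (m + 1)) < (b : ℝ) ^ (m + 1) := by
    set G : ℕ → ℝ := fun k => ((k : ℝ) + 1) ^ (m + 1) - (k : ℝ) ^ (m + 1) with hG
    have hGpos : ∀ k, 0 < G k := fun k => by
      have : (k : ℝ) ^ (m + 1) < ((k : ℝ) + 1) ^ (m + 1) :=
        pow_lt_pow_left₀ (by linarith) (by positivity) (by omega)
      simp only [hG]; linarith
    have htot : ∑ k ∈ Finset.range b, G k = (b : ℝ) ^ (m + 1) := by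
      have := Finset.sum_range_sub (fun k : ℕ => (k : ℝ) ^ (m + 1)) b
      simp only [Nat.cast_add, Nat.cast_one, Nat.cast_zero] at this
      simp only [hG]; rw [this]; simp
    have hinj : Function.Injective fun a : ℕ => a + (b - 1 - f) := fun x y h => by
      simpa using h
    have himg : ∑ a ∈ A, G (a + (b - 1 - f)) = ∑ k ∈ A.image (fun a => a + (b - 1 - f)), G k := by
      rw [Finset.sum_image (fun x _ y _ h => hinj h)]
    have hsub : A.image (fun a => a + (b - 1 - f)) ⊆ Finset.range b := by
      intro k hk
      obtain ⟨a, ha, rfl⟩ := Finset.mem_image.1 hk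
      have := hf a ha
      simp only [Finset.mem_range]; omega
    have hne : ∃ k ∈ Finset.range b, k ∉ A.image (fun a => a + (b - 1 - f)) := by
      by_contra! hc
      have := Finset.card_le_card (fun k hk => hc k hk)
      rw [Finset.card_range, Finset.card_image_of_injective _ hinj] at this
      omega
    obtain ⟨k, hk, hk'⟩ := hne
    change ∑ a ∈ A, G (a + (b - 1 - f)) < _
    rw [himg, ← htot]
    exact Finset.sum_lt_sum_of_subset hsub hk hk' (hGpos k) fun j _ _ => (hGpos j).le
  have hN : (A.card : ℝ) < (b : ℝ) ^ (m + 1) := by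
    have : b ≤ b ^ (m + 1) := Nat.le_self_pow (by omega) b
    exact_mod_cast lt_of_lt_of_le hcard this
  have step4 := div_lt_div_of_pos_right step3 (by positivity : (0 : ℝ) < (m : ℝ) + 1)
  by_contra! hc
  have := mul_nonneg (sub_nonneg.2 hN.le) (sub_nonneg.2 hc)
  have e1 : (b : ℝ) ^ (m + 1) / ((m : ℝ) + 1) = (b : ℝ) ^ (m + 1) * (1 / ((m : ℝ) + 1)) := by ring
  rw [e1] at step4
  linarith

lemma lower_aux {b : ℕ} (hb : 1 < b) {A : Finset ℕ} {f : ℕ}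
    (hf0 : 0 < f) (hf : f ∈ A) (e : ℕ → ℝ) (he0 : e 0 = 1)
    (hpos : ∀ j, 0 ≤ e j)
    (hrec : ∀ m, 1 ≤ m → (b : ℝ) ^ (m + 1) * e m = ∑ a ∈ A, ∑ j ∈ Finset.range (m + 1),
      (((b : ℝ) - 1) / f * a) ^ (m - j) * (m.choose j) * e j) (m : ℕ) (hm : 1 ≤ m) :
    (b : ℝ)⁻¹ * (1 / ((m : ℝ) + 1)) < e m := by
  induction m using Nat.strong_induction_on with
  | _ m ih =>
  have hb1 : (1 : ℝ) < b := by exact_mod_cast hb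
  have hf0' : (0 : ℝ) < f := by exact_mod_cast hf0
  have hle : ∀ j < m, (b : ℝ)⁻¹ * (1 / ((j : ℝ) + 1)) + (if j = 0 then 1 - (b : ℝ)⁻¹ else 0) ≤ e j := by
    intro j hj
    rcases Nat.eq_zero_or_pos j with rfl | h
    · simp [he0]
    · rw [if_neg (by omega), add_zero]; exact (ih j hj h).le
  have step1 := hrec m hm
  have step2 := Finset.single_le_sum (s := A) (f := fun a : ℕ => ∑ j ∈ Finset.range (m + 1),
      (((b : ℝ) - 1) / f * a) ^ (m - j) * (m.choose j) * e j) (fun a _ =>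
        Finset.sum_nonneg fun j _ => mul_nonneg (mul_nonneg (pow_nonneg (mul_nonneg
          (div_nonneg (by linarith) hf0'.le) (by positivity)) _) (by positivity)) (hpos j)) hf
  simp only [← step1, div_mul_cancel₀ _ hf0'.ne'] at step2
  have hT := T_eq ((b : ℝ) - 1) m
  rw [Finset.sum_range_succ] at step2 hT
  have step3 : ∑ j ∈ Finset.range m, ((b : ℝ) - 1) ^ (m - j) * (m.choose j) *
      ((b : ℝ)⁻¹ * (1 / ((j : ℝ) + 1)) + (if j = 0 then 1 - (b : ℝ)⁻¹ else 0)) ≤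
      ∑ j ∈ Finset.range m, ((b : ℝ) - 1) ^ (m - j) * (m.choose j) * e j := by
    refine Finset.sum_le_sum fun j hj => ?_
    exact mul_le_mul_of_nonneg_left (hle j (Finset.mem_range.1 hj))
      (mul_nonneg (pow_nonneg (by linarith) _) (by positivity))
  have step4 : ∑ j ∈ Finset.range m, ((b : ℝ) - 1) ^ (m - j) * (m.choose j) *
      ((b : ℝ)⁻¹ * (1 / ((j : ℝ) + 1)) + (if j = 0 then 1 - (b : ℝ)⁻¹ else 0)) =
      (b : ℝ)⁻¹ * ∑ j ∈ Finset.range m, ((b : ℝ) - 1) ^ (m - j) * (m.choose j) *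
        (1 / ((j : ℝ) + 1)) + (1 - (b : ℝ)⁻¹) * ((b : ℝ) - 1) ^ m := by
    simp only [mul_add, Finset.sum_add_distrib, mul_ite, mul_zero, Finset.sum_ite_eq',
      Finset.mem_range]
    rw [if_pos (by omega), Finset.mul_sum]
    congr 1
    · exact Finset.sum_congr rfl fun j _ => by ring
    · simp; ring
  simp only [Nat.sub_self, pow_zero, Nat.choose_self, Nat.cast_one, one_mul, sub_add_cancel]
    at step2 hT
  rw [step4] at step3
  set S := ∑ j ∈ Finset.range m, ((b : ℝ) - 1) ^ (m - j) * (m.choose j) * (1 / ((j : ℝ) + 1))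
  have hS : S = ((b : ℝ) ^ (m + 1) - ((b : ℝ) - 1) ^ (m + 1)) / ((m : ℝ) + 1)
      - 1 / ((m : ℝ) + 1) := by linarith
  have hB : (1 : ℝ) < (b : ℝ) ^ (m + 1) := one_lt_pow₀ hb1 (by omega)
  have hq : 0 < ((b : ℝ) - 1) ^ (m + 1) := pow_pos (by linarith) _
  have hm1 : 1 / ((m : ℝ) + 1) < 1 := by
    rw [div_lt_one (by positivity)]
    have : (1 : ℝ) ≤ m := by exact_mod_cast hm
    linarith
  have hbi : 0 < (b : ℝ)⁻¹ := by positivity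
  have e2 : (1 - (b : ℝ)⁻¹) * ((b : ℝ) - 1) ^ m = (b : ℝ)⁻¹ * ((b : ℝ) - 1) ^ (m + 1) := by
    rw [pow_succ]; field_simp
  rw [e2, hS] at step3
  have key : 0 < (b : ℝ)⁻¹ * (((b : ℝ) - 1) ^ (m + 1) * (1 - 1 / ((m : ℝ) + 1))) :=
    mul_pos hbi (mul_pos hq (by linarith))
  rw [div_eq_mul_one_div _ ((m : ℝ) + 1)] at step3
  generalize 1 / ((m : ℝ) + 1) = r at *
  by_contra! hc
  have := mul_nonneg (sub_nonneg.2 hB.le) (sub_nonneg.2 hc)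
  nlinarith

theorem kempner_lambda_bounds (b : ℕ) (hb : 1 < b) (A : Finset ℕ)
    (hA : A ⊂ Finset.range b) (hAne : A.Nonempty) (hA0 : A ≠ {0}) :
    kempnerLambda b A hAne 1 = 1
      ∧ ∀ m : ℕ, 2 ≤ m →
          (b : ℝ)⁻¹ < kempnerLambda b A hAne m ∧ kempnerLambda b A hAne m < 1 := by
  
  set f := A.max' hAne with hfdef
  have hfA : f ∈ A := A.max'_mem hAne
  have hfle : ∀ a ∈ A, a ≤ f := fun a ha => A.le_max' a ha
  have hfb : f < b := Finset.mem_range.1 (hA.1 hfA)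
  have hf0 : 0 < f := by
    rcases Nat.eq_zero_or_pos f with h | h
    · exfalso
      apply hA0
      ext a
      rw [Finset.mem_singleton]
      constructor
      · intro ha
        have := hfle a ha
        omega
      · rintro rfl
        rwa [h] at hfA
    · exact h
  have hb0 : (b : ℝ) ≠ 0 := by positivity
  have hu0 : 0 < kU b A 0 := by
    rw [kU_rec hb hA 0]
    have : 0 ≤ ((b : ℝ) ^ (0 + 1))⁻¹ * ∑ a ∈ A, ∑ j ∈ Finset.range (0 + 1),
        (a : ℝ) ^ (0 - j) * (Nat.choose 0 j) * kU b A j :=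
      mul_nonneg (by positivity) (Finset.sum_nonneg fun a _ => Finset.sum_nonneg fun j _ =>
        mul_nonneg (by positivity) (kU_nonneg ..))
    rw [pow_zero]; linarith
  set c : ℝ := ((b : ℝ) - 1) / (f : ℝ) with hc
  have hf0' : (0 : ℝ) < f := by exact_mod_cast hf0
  have hb1 : (1 : ℝ) < b := by exact_mod_cast hb
  have hc0 : 0 ≤ c := div_nonneg (by linarith) hf0'.le
  let e : ℕ → ℝ := fun j => c ^ j * kU b A j / kU b A 0
  have he0 : e 0 = 1 := by
    simp only [e, pow_zero, one_mul]; exact div_self hu0.ne'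
  have hpos : ∀ j, 0 ≤ e j := fun j =>
    div_nonneg (mul_nonneg (pow_nonneg hc0 j) (kU_nonneg ..)) hu0.le
  have hrec : ∀ m, 1 ≤ m → (b : ℝ) ^ (m + 1) * e m = ∑ a ∈ A, ∑ j ∈ Finset.range (m + 1),
      (((b : ℝ) - 1) / f * a) ^ (m - j) * (m.choose j) * e j := by
    intro m hm
    have h := kU_rec hb hA m
    rw [zero_pow (by omega), zero_add] at h
    simp only [e]
    rw [h, mul_div_assoc', mul_left_comm, mul_inv_cancel_left₀ (by positivity), mul_div_assoc,
      Finset.sum_div, Finset.mul_sum]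
    refine Finset.sum_congr rfl fun a _ => ?_
    rw [Finset.sum_div, Finset.mul_sum]
    refine Finset.sum_congr rfl fun j hj => ?_
    have hj' : m = (m - j) + j := by have := Finset.mem_range.1 hj; omega
    have : c ^ m = c ^ (m - j) * c ^ j := by rw [← pow_add, ← hj']
    rw [this, ← hc, mul_pow]
    ring
  have hlam : ∀ m, kempnerLambda b A hAne (m + 1) = ((m : ℝ) + 1) * e m := by
    intro m
    simp only [kempnerLambda, kU_eq hb hA, e, Nat.add_sub_cancel, ← hfdef, ← hc]
    push_cast
    ring
  constructor
  · have := hlam 0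
    rw [zero_add] at this
    rw [this, he0]; simp
  · intro m hm
    obtain ⟨k, rfl⟩ : ∃ k, m = k + 1 := ⟨m - 1, by omega⟩
    have h1 := upper_aux hb (card_lt hA) hf0 hfb hfle e he0 hpos hrec k (by omega)
    have h2 := lower_aux hb hf0 hfA e he0 hpos hrec k (by omega)
    have hk : (0 : ℝ) < (k : ℝ) + 1 := by positivity
    rw [hlam]
    constructor
    · rw [mul_one_div, div_lt_iff₀ hk] at h2
      linarith
    · rw [lt_div_iff₀ hk] at h1
      linarith
end
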